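/- arXiv:1506.02878 — 4 statements merged into one kernel-verified Lean document; each statement's English description precedes it below -/
import Mathlib

section
/- Let k be a commutative ring, let C_k° be a k-linear triangulated category with split idempotents, and suppose we are given a degeneration data for C_k°, consisting of: a triangulated category C_k with split idempotents together with a fully faithful triangulated embedding C_k° → C_k (we regard C_k° as a full subcategory of C_k); a triangulated category C_V with split idempotents together with a full triangulated subcategory C_V°; triangulated functors ↑ : C_k → C_V with X↑ ∈ C_V° for every object X of C_k°, and Φ : C_V° → C_k; and a natural transformation t : id_{C_V} → id_{C_V} of triangulated functors (i.e. commuting with the shift), such that (i) for each object M of C_k° the morphism Φ(t_{M↑}) : Φ(M↑) → Φ(M↑) is a split monomorphism in C_k, and (ii) for each object M of C_k°, if M↑ →(t_{M↑}) M↑ → C → M↑[1] is a distinguished triangle in C_V° then Φ(C) ≅ M in C_k. Let M, N be objects of C_k° and suppose there is an object Q of C_V° such that p(Q) ≅ p(M↑) in the localization C_V°[t^{-1}] of C_V° at the multiplicative system {t_X^n : X object of C_V°, n ∈ ℕ} (where p denotes the localization functor), and such that Φ(cone(t_Q)) ≅ N, i.e. whenever Q →(t_Q) Q → C' → Q[1]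 is a distinguished triangle in C_V° then Φ(C') ≅ N. Then there exist an object Z of C_k°, a nilpotent endomorphism v : Z → Z, a morphism u : Z → M, and morphisms w : Z ⊕ M → N and δ : N → Z[1] such that Z →(v,u)ᵗ Z ⊕ M →w N →δ Z[1] is a distinguished triangle. -/
open CategoryTheory Limits Pretriangulated

universe w v₀ u₀ v₁ u₁ v₂ u₂ v₃ u₃

/-- The `n`-th power `t_X^n : X ⟶ X` of a natural transformation `t : 𝟭 C ⟶ 𝟭 C`
evaluated at `X`. -/
def tpow {C : Type u₀} [Category.{v₀} C] (t : 𝟭 C ⟶ 𝟭 C) (X : C) : ℕ → (X ⟶ X)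
  | 0 => 𝟙 X
  | (n + 1) => tpow t X n ≫ t.app X

/-- The multiplicative system `Σ = {t_X^n : X object of C, n ∈ ℕ}`. -/
def sigmaT {C : Type u₀} [Category.{v₀} C] (t : 𝟭 C ⟶ 𝟭 C) : MorphismProperty C :=
  fun X Y f => ∃ (n : ℕ) (e : X = Y), f = tpow t X n ≫ eqToHom e

section Powers

variable {C : Type u₀} [Category.{v₀} C] (t : 𝟭 C ⟶ 𝟭 C)

lemma tpow_naturality {X Y : C} (f : X ⟶ Y) (n : ℕ) :
    f ≫ tpow t Y n = tpow t X n ≫ f := by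
  induction n with
  | zero => simp [tpow]
  | succ n ih =>
    have := t.naturality f
    dsimp at this
    simp only [tpow, Category.assoc, ← this]
    rw [reassoc_of% ih]

lemma tpow_add (X : C) (m n : ℕ) : tpow t X (m + n) = tpow t X m ≫ tpow t X n := by
  induction n with
  | zero => simp [tpow]
  | succ n ih =>
    rw [← add_assoc]
    simp only [tpow, ih, Category.assoc]

lemma tpow_eq_pow (X : C) (n : ℕ) : tpow t X n = End.of (t.app X) ^ n := by
  induction n with
  | zero => rfl
  | succ n ih => rw [pow_succ', End.mul_def, tpow, ih]

lemma sigmaT_tpow (X : C) (n : ℕ) : sigmaT t (tpow t X n) := ⟨n, rfl, by simp⟩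

instance sigmaT_hasLeftCalculusOfFractions : (sigmaT t).HasLeftCalculusOfFractions where
  id_mem X := ⟨0, rfl, by simp [tpow]⟩
  comp_mem := by
    rintro X Y Z _ _ ⟨m, rfl, rfl⟩ ⟨n, rfl, rfl⟩
    exact ⟨m + n, rfl, by simp [tpow_add]⟩
  exists_leftFraction := by
    rintro X Y ⟨s, ⟨n, e, rfl⟩, f⟩
    subst e
    exact ⟨⟨f, tpow t Y n, sigmaT_tpow t Y n⟩, by simp [tpow_naturality]⟩
  ext := by
    rintro X' X Y f₁ f₂ _ ⟨n, rfl, rfl⟩ h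
    refine ⟨Y, tpow t Y n, sigmaT_tpow t Y n, ?_⟩
    simpa [tpow_naturality] using h

lemma exists_comp_Q_map_tpow {X Y : C} (φ : (sigmaT t).Q.obj X ⟶ (sigmaT t).Q.obj Y) :
    ∃ (n : ℕ) (f : X ⟶ Y), φ ≫ (sigmaT t).Q.map (tpow t Y n) = (sigmaT t).Q.map f := by
  obtain ⟨⟨f, s, ⟨n, e, hs⟩⟩, rfl⟩ := Localization.exists_leftFraction (sigmaT t).Q (sigmaT t) φ
  subst e hs
  refine ⟨n, f, ?_⟩
  simpa using MorphismProperty.LeftFraction.map_comp_map_s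
    (W := sigmaT t) ⟨f, tpow t Y n ≫ eqToHom rfl, n, rfl, rfl⟩ (sigmaT t).Q
      (Localization.inverts _ _)

lemma exists_comp_tpow_eq_of_Q_map_eq {X : C} {f : X ⟶ X} {n : ℕ}
    (h : (sigmaT t).Q.map f = (sigmaT t).Q.map (tpow t X n)) :
    ∃ c : ℕ, f ≫ tpow t X c = tpow t X (n + c) := by
  obtain ⟨Z, _, ⟨c, rfl, rfl⟩, hc⟩ :=
    (MorphismProperty.map_eq_iff_postcomp (sigmaT t).Q (sigmaT t) _ _).1 h
  exact ⟨c, by simpa [tpow_add] using hc⟩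

/-- Objects that become isomorphic after inverting `t` are related by morphisms whose two
composites are a common power of `t`. -/
lemma exists_comp_eq_tpow_of_Q_iso {X Y : C} (φ : (sigmaT t).Q.obj X ≅ (sigmaT t).Q.obj Y) :
    ∃ (n : ℕ) (f : X ⟶ Y) (g : Y ⟶ X), f ≫ g = tpow t X n ∧ g ≫ f = tpow t Y n := by
  obtain ⟨a, f, hf⟩ := exists_comp_Q_map_tpow t φ.hom
  obtain ⟨b, g, hg⟩ := exists_comp_Q_map_tpow t φ.inv
  have h₁ : (sigmaT t).Q.map (f ≫ g) = (sigmaT t).Q.map (tpow t X (a + b)) := by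
    rw [Functor.map_comp, ← hf, Category.assoc, ← Functor.map_comp, ← tpow_naturality,
      Functor.map_comp, ← hg, Category.assoc, Iso.hom_inv_id_assoc, ← Functor.map_comp,
      ← tpow_add, add_comm]
  have h₂ : (sigmaT t).Q.map (g ≫ f) = (sigmaT t).Q.map (tpow t Y (a + b)) := by
    rw [Functor.map_comp, ← hg, Category.assoc, ← Functor.map_comp, ← tpow_naturality,
      Functor.map_comp, ← hf, Category.assoc, Iso.inv_hom_id_assoc, ← Functor.map_comp,
      ← tpow_add]
  obtain ⟨c, hc⟩ := exists_comp_tpow_eq_of_Q_map_eq t h₁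
  obtain ⟨d, hd⟩ := exists_comp_tpow_eq_of_Q_map_eq t h₂
  refine ⟨a + b + c + d, f, g ≫ tpow t X (c + d), ?_, ?_⟩
  · rw [tpow_add t X c d, ← Category.assoc, ← Category.assoc, Category.assoc f g, ← Category.assoc,
      hc, ← tpow_add]
  · rw [Category.assoc, ← tpow_naturality, ← Category.assoc, add_comm c d, tpow_add t Y d c,
      ← Category.assoc, hd, ← tpow_add]
    congr 1
    omega

end Powers

section Retracts

lemma isStableUnderRetracts_essImage {C : Type u₀} [Category.{v₀} C] {D : Type u₁}
    [Category.{v₁} D] (F : C ⥤ D) [F.Full] [F.Faithful] [IsIdempotentComplete C] :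
    F.essImage.IsStableUnderRetracts where
  of_retract := by
    rintro X Y r ⟨A, ⟨e⟩⟩
    obtain ⟨B, i, p, h₁, h₂⟩ := IsIdempotentComplete.idempotents_split A
      (F.preimage (e.hom ≫ r.r ≫ r.i ≫ e.inv)) (F.map_injective (by simp))
    have h₁' := congrArg F.map h₁
    have h₂' := congrArg F.map h₂
    simp only [Functor.map_comp, Functor.map_preimage] at h₁' h₂'
    refine ⟨B, ⟨⟨F.map i ≫ e.hom ≫ r.r, r.i ≫ e.inv ≫ F.map p, ?_, ?_⟩⟩⟩
    · have : F.map i ≫ (e.hom ≫ r.r ≫ r.i ≫ e.inv) ≫ F.map p = 𝟙 _ := by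
        rw [← h₂', Category.assoc, h₁', F.map_id, Category.comp_id, h₁', F.map_id]
      simpa using this
    · simp [reassoc_of% h₂']

end Retracts

section Nilpotent

variable {C : Type u₀} [Category.{v₀} C] [Preadditive C]
  {D : Type u₁} [Category.{v₁} D] [Preadditive D] (F : C ⥤ D) [F.Additive]

lemma isNilpotent_map {X : C} {x : End X} (hx : IsNilpotent x) :
    IsNilpotent (End.of (F.map x)) := by
  obtain ⟨n, hn⟩ := hx
  refine ⟨n, ((map_pow (F.mapEnd X) x n).symm).trans ?_⟩
  rw [hn]
  exact F.map_zero X X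

lemma isNilpotent_of_map [F.Faithful] {X : C} {x : End X}
    (hx : IsNilpotent (End.of (F.map x))) : IsNilpotent x := by
  obtain ⟨n, hn⟩ := hx
  refine ⟨n, F.map_injective ?_⟩
  exact (map_pow (F.mapEnd X) x n).trans (hn.trans (F.map_zero X X).symm)

end Nilpotent

section Triangulated

variable {C : Type u₀} [Category.{v₀} C] [Preadditive C] [HasZeroObject C]
  [HasShift C ℤ] [∀ n : ℤ, (shiftFunctor C n).Additive] [Pretriangulated C]

/-- An object with a nilpotent endomorphism whose cone lies in a thick subcategory lies in that
subcategory. -/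
lemma prop_of_trW_of_isNilpotent [IsTriangulated C] (P : ObjectProperty C) [P.IsTriangulated]
    [P.IsStableUnderRetracts] {Z : C} (v : End Z) (hv : P.trW (v : Z ⟶ Z))
    (hnil : IsNilpotent v) : P Z := by
  have hpow (n : ℕ) : P.trW (v ^ n : End Z) := by
    induction n with
    | zero => exact P.trW.id_mem Z
    | succ n ih =>
      rw [pow_succ, End.mul_def]
      exact P.trW.comp_mem _ _ hv ih
  obtain ⟨n, hn⟩ := hnil
  have h₀ : P.trW (0 : Z ⟶ Z) := by
    have := hpow n
    rw [hn] at this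
    exact this
  obtain ⟨K, b, c, hT, hK⟩ := (P.trW_iff _).1 h₀
  obtain ⟨r, hr⟩ := Triangle.yoneda_exact₂ _ hT (𝟙 Z) zero_comp
  exact P.prop_of_retract ⟨b, r, hr.symm⟩ hK

/-- Let `w` be an endomorphism of the cone of `f : X ⟶ Y` that is part of an endomorphism
`(x, y, w)` of the triangle. If `x ^ n` and `y ^ n` both factor through `f`, by means of the same
`g : Y ⟶ X`, then `w` is nilpotent. -/
lemma isNilpotent_of_comp_eq {X Y K : C} {f : X ⟶ Y} {i : Y ⟶ K} {d : K ⟶ X⟦(1 : ℤ)⟧}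
    (hT : Triangle.mk f i d ∈ distTriang C) (x : End X) (y : End Y) (w : End K)
    (hi : i ≫ w = (y : Y ⟶ Y) ≫ i) (hd : (w : K ⟶ K) ≫ d = d ≫ (x : X ⟶ X)⟦(1 : ℤ)⟧')
    (n : ℕ) (g : Y ⟶ X) (hx : (x ^ n : End X) = f ≫ g) (hy : (y ^ n : End Y) = g ≫ f) :
    IsNilpotent w := by
  have hi' (m : ℕ) : i ≫ (w ^ m : End K) = (y ^ m : End Y) ≫ i := by
    induction m with
    | zero => simp [End.one_def]
    | succ m ih =>
      rw [pow_succ, pow_succ, End.mul_def, End.mul_def, ← Category.assoc, hi, Category.assoc, ih,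
        Category.assoc]
  have hd' (m : ℕ) : (w ^ m : End K) ≫ d = d ≫ (x ^ m : End X)⟦(1 : ℤ)⟧' := by
    induction m with
    | zero => simp [End.one_def]
    | succ m ih =>
      rw [pow_succ, pow_succ, End.mul_def, End.mul_def, Category.assoc, ih, ← Category.assoc, hd,
        Category.assoc, Functor.map_comp]
  have h₁ : f ≫ i = 0 := comp_distTriang_mor_zero₁₂ _ hT
  have h₂ : d ≫ f⟦(1 : ℤ)⟧' = 0 := comp_distTriang_mor_zero₃₁ _ hT
  obtain ⟨r, hr⟩ := Triangle.yoneda_exact₃ _ hT (w ^ n : End K) (by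
    change i ≫ (w ^ n : End K) = 0
    rw [hi', hy, Category.assoc, h₁, comp_zero])
  replace hr : (w ^ n : End K) = d ≫ r := hr
  have h₃ : (w ^ n : End K) ≫ d = 0 := by
    rw [hd', hx, Functor.map_comp, reassoc_of% h₂, zero_comp]
  refine ⟨n + n, ?_⟩
  rw [pow_add, End.mul_def]
  conv_lhs => arg 2; rw [hr]
  exact (Category.assoc _ _ _).symm.trans ((congrArg (· ≫ r) h₃).trans zero_comp)

/-- If `f : A ⟶ B` is invertible up to a power of `t` and `Φ(t_A)` is a split monomorphism, then
`Z = Φ(cone f)` fits in a triangle `Z ⟶ Φ(cone t_A) ⊞ Z ⟶ Φ(cone t_B) ⟶ Z⟦1⟧` whose component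
`Z ⟶ Z` is nilpotent. -/
lemma exists_biprod_triangle_of_comp_eq_tpow [IsTriangulated C]
    {D : Type u₁} [Category.{v₁} D] [Preadditive D] [HasZeroObject D]
    [HasShift D ℤ] [∀ n : ℤ, (shiftFunctor D n).Additive] [Pretriangulated D]
    (Φ : C ⥤ D) [Φ.CommShift ℤ] [Φ.IsTriangulated] (t : 𝟭 C ⟶ 𝟭 C)
    {A B KA KB : C} {n : ℕ} (f : A ⟶ B) (g : B ⟶ A)
    (hfg : f ≫ g = tpow t A n) (hgf : g ≫ f = tpow t B n)
    [IsSplitMono (Φ.map (t.app A))]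
    {iA : A ⟶ KA} {dA : KA ⟶ A⟦(1 : ℤ)⟧} (hA : Triangle.mk (t.app A) iA dA ∈ distTriang C)
    {iB : B ⟶ KB} {dB : KB ⟶ B⟦(1 : ℤ)⟧} (hB : Triangle.mk (t.app B) iB dB ∈ distTriang C) :
    ∃ (Z Y : D) (a : Z ⟶ Y) (p : Y ⟶ Φ.obj KB) (q : Φ.obj KB ⟶ Z⟦(1 : ℤ)⟧)
      (e : Y ≅ Φ.obj KA ⊞ Z), Triangle.mk a p q ∈ distTriang D ∧
        IsNilpotent (End.of (a ≫ e.hom ≫ biprod.snd)) := by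
  have comm : f ≫ t.app B = t.app A ≫ f := t.naturality f
  obtain ⟨K, i, d, hf⟩ := distinguished_cocone_triangle f
  obtain ⟨L, i', d', hL⟩ := distinguished_cocone_triangle (t.app A ≫ f)
  let o₁ := Triangulated.someOctahedron rfl hA hf hL
  let o₂ := Triangulated.someOctahedron comm hf hB hL
  have hnil : IsNilpotent (End.of (o₂.m₁ ≫ o₁.m₃)) := by
    refine isNilpotent_of_comp_eq hf (t.app A) (t.app B) _ ?_ ?_ n g ?_ ?_
    · exact (o₂.comm₁_assoc _).trans (congrArg (t.app B ≫ ·) o₁.comm₃)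
    · refine (Category.assoc _ _ _).trans ?_
      rw [← o₁.comm₄, o₂.comm₂_assoc]
    · exact (hfg.trans (tpow_eq_pow t A n)).symm
    · exact (hgf.trans (tpow_eq_pow t B n)).symm
  have hsplit : IsSplitMono (Φ.map (tpow t A n)) := by
    clear hfg hgf hnil
    induction n with
    | zero =>
      rw [tpow, Φ.map_id]
      infer_instance
    | succ n ih =>
      rw [tpow, Φ.map_comp]
      infer_instance
  have hd : Φ.map d ≫ (Φ.commShiftIso (1 : ℤ)).hom.app A = 0 := by
    have h₂ : d ≫ f⟦(1 : ℤ)⟧' = 0 := comp_distTriang_mor_zero₃₁ _ hf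
    rw [← cancel_mono ((Φ.map (tpow t A n))⟦(1 : ℤ)⟧'), zero_comp, Category.assoc,
      ← Φ.commShiftIso_hom_naturality, ← hfg, Functor.map_comp, ← Φ.map_comp_assoc,
      reassoc_of% h₂]
    simp
  obtain ⟨e, -, he⟩ := exists_iso_binaryBiproduct_of_distTriang _ (Φ.map_distinguished _ o₁.mem)
    (by
      change Φ.map (d ≫ iA⟦(1 : ℤ)⟧') ≫ (Φ.commShiftIso (1 : ℤ)).hom.app KA = 0
      rw [Φ.map_comp, Category.assoc, Φ.commShiftIso_hom_naturality]
      exact (Category.assoc _ _ _).symm.trans ((congrArg (· ≫ _) hd).trans zero_comp))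
  refine ⟨Φ.obj K, Φ.obj L, Φ.map o₂.m₁, Φ.map o₂.m₃, _, e, Φ.map_distinguished _ o₂.mem, ?_⟩
  have hv : Φ.map (o₂.m₁ ≫ o₁.m₃) = Φ.map o₂.m₁ ≫ e.hom ≫ biprod.snd :=
    (Φ.map_comp _ _).trans (congrArg (Φ.map o₂.m₁ ≫ ·) he)
  have := isNilpotent_map Φ hnil
  exact hv ▸ this

end Triangulated

/-- Transport of a triangle `Z ⟶ M ⊞ Z ⟶ N ⟶ Z⟦1⟧` with nilpotent component `Z ⟶ Z` along a
fully faithful triangulated functor whose essential image contains `M` and `N`. -/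
lemma exists_biprod_lift_triangle_of_fullyFaithful
    {C : Type u₀} [Category.{v₀} C] [Preadditive C] [HasZeroObject C]
    [HasShift C ℤ] [∀ n : ℤ, (shiftFunctor C n).Additive] [Pretriangulated C]
    [IsIdempotentComplete C]
    {D : Type u₁} [Category.{v₁} D] [Preadditive D] [HasZeroObject D]
    [HasShift D ℤ] [∀ n : ℤ, (shiftFunctor D n).Additive] [Pretriangulated D] [IsTriangulated D]
    (F : C ⥤ D) [F.CommShift ℤ] [F.IsTriangulated] [F.Full] [F.Faithful]
    {M N : C} {M' N' Z' Y : D} (m : M' ≅ F.obj M) (l : N' ≅ F.obj N)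
    {a : Z' ⟶ Y} {p : Y ⟶ N'} {q : N' ⟶ Z'⟦(1 : ℤ)⟧} (hT : Triangle.mk a p q ∈ distTriang D)
    (e : Y ≅ M' ⊞ Z') (hnil : IsNilpotent (End.of (a ≫ e.hom ≫ biprod.snd))) :
    ∃ (Z : C) (v : End Z) (u : Z ⟶ M) (w : Z ⊞ M ⟶ N) (d : N ⟶ Z⟦(1 : ℤ)⟧),
      IsNilpotent v ∧ Triangle.mk (biprod.lift (v : Z ⟶ Z) u) w d ∈ distTriang C := by
  have := isStableUnderRetracts_essImage F
  obtain ⟨Z, ⟨z⟩⟩ : F.essImage Z' := by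
    refine prop_of_trW_of_isNilpotent F.essImage _ ?_ hnil
    refine F.essImage.trW.comp_mem _ _ (ObjectProperty.trW.mk _ hT ⟨N, ⟨l.symm⟩⟩)
      (F.essImage.trW.comp_mem _ _ (F.essImage.trW_of_isIso _) ?_)
    exact ObjectProperty.trW.mk' _ (binaryBiproductTriangle_distinguished M' Z') ⟨M, ⟨m.symm⟩⟩
  let s : F.obj (Z ⊞ M) ≅ F.obj Z ⊞ F.obj M :=
    { hom := biprod.lift (F.map biprod.fst) (F.map biprod.snd)
      inv := biprod.desc (F.map biprod.inl) (F.map biprod.inr)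
      hom_inv_id := by
        rw [biprod.lift_desc, ← F.map_comp, ← F.map_comp, ← F.map_add, biprod.total, F.map_id]
      inv_hom_id := by
        ext <;> simp [← F.map_comp] }
  let y : F.obj (Z ⊞ M) ≅ Y :=
    s ≪≫ biprod.braiding _ _ ≪≫ biprod.mapIso m.symm z ≪≫ e.symm
  have hy : y.inv ≫ F.map biprod.fst = e.hom ≫ biprod.snd ≫ z.inv := by
    simp [y, s, ← F.map_comp]
  let b : Z ⟶ Z ⊞ M := F.preimage (z.hom ≫ a ≫ y.inv)
  have hb : F.map b = z.hom ≫ a ≫ y.inv := F.map_preimage _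
  let w : Z ⊞ M ⟶ N := F.preimage (y.hom ≫ p ≫ l.hom)
  let d : N ⟶ Z⟦(1 : ℤ)⟧ :=
    F.preimage (l.inv ≫ q ≫ z.inv⟦(1 : ℤ)⟧' ≫ (F.commShiftIso (1 : ℤ)).inv.app Z)
  refine ⟨Z, b ≫ biprod.fst, b ≫ biprod.snd, w, d, ?_, ?_⟩
  · refine isNilpotent_of_map F ?_
    have hv : F.map (b ≫ biprod.fst) = z.symm.conj (End.of (a ≫ e.hom ≫ biprod.snd)) := by
      rw [F.map_comp, hb, Category.assoc, Category.assoc, hy]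
      simp [Iso.conj_apply, End.of]
    rw [hv]
    exact hnil.map z.symm.conj
  · have hlift : biprod.lift (b ≫ biprod.fst) (b ≫ biprod.snd) = b := by
      ext <;> simp
    rw [← F.map_distinguished_iff]
    rw [hlift]
    refine isomorphic_distinguished _ hT _
      (Triangle.isoMk _ _ z y l.symm ?_ ?_ ?_)
    · change F.map b ≫ y.hom = z.hom ≫ a
      simp [hb]
    · change F.map w ≫ l.inv = y.hom ≫ p
      simp [w]
    · change (F.map d ≫ (F.commShiftIso (1 : ℤ)).hom.app Z) ≫ z.hom⟦(1 : ℤ)⟧' = l.inv ≫ q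
      simp [d, ← Functor.map_comp]


/-- Categorical degeneration implies triangle degeneration.

`C0` is the `k`-linear triangulated category `C_k^∘` with split idempotents; the
degeneration data consists of: a triangulated category `Ck` with split idempotents
together with a fully faithful triangulated embedding `ι : C0 ⥤ Ck`; a triangulated
category `CV` with split idempotents together with a full triangulated subcategory,
modelled as a fully faithful triangulated embedding `j : CV0 ⥤ CV`; triangulated functors
`up : Ck ⥤ CV` (with `X↑ ∈ CV0` for `X ∈ C0`, witnessed by `up0` and the natural
isomorphism `hup`) and `Φ : CV0 ⥤ Ck`; and a natural transformation `t : 𝟭 CV ⟶ 𝟭 CV`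
commuting with the shift (restricting to `t0` on `CV0`), such that
(i) `Φ(t_{M↑})` is a split monomorphism for every `M` in `C0`, and
(ii) `Φ(cone(t_{M↑})) ≅ M` for every `M` in `C0`.
If `Q` in `CV0` satisfies `p(Q) ≅ p(M↑)` in the localization `CV0[t⁻¹]` and
`Φ(cone(t_Q)) ≅ N`, then there is a distinguished triangle
`Z →(v,u)ᵗ Z ⊞ M → N → Z⟦1⟧` in `C0` with `v` nilpotent. -/
theorem stmt_0
    (k : Type w) [CommRing k]
    -- the category C_k^∘
    (C0 : Type u₀) [Category.{v₀} C0] [Preadditive C0] [HasZeroObject C0]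
    [HasShift C0 ℤ] [∀ n : ℤ, (shiftFunctor C0 n).Additive] [Pretriangulated C0]
    [IsTriangulated C0] [CategoryTheory.Linear k C0] [IsIdempotentComplete C0]
    -- the category C_k
    (Ck : Type u₁) [Category.{v₁} Ck] [Preadditive Ck] [HasZeroObject Ck]
    [HasShift Ck ℤ] [∀ n : ℤ, (shiftFunctor Ck n).Additive] [Pretriangulated Ck]
    [IsTriangulated Ck] [IsIdempotentComplete Ck]
    (ι : C0 ⥤ Ck) [ι.CommShift ℤ] [ι.IsTriangulated] [ι.Full] [ι.Faithful]
    -- the category C_V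
    (CV : Type u₂) [Category.{v₂} CV] [Preadditive CV] [HasZeroObject CV]
    [HasShift CV ℤ] [∀ n : ℤ, (shiftFunctor CV n).Additive] [Pretriangulated CV]
    [IsTriangulated CV] [IsIdempotentComplete CV]
    -- the full triangulated subcategory C_V^∘ of C_V
    (CV0 : Type u₃) [Category.{v₃} CV0] [Preadditive CV0] [HasZeroObject CV0]
    [HasShift CV0 ℤ] [∀ n : ℤ, (shiftFunctor CV0 n).Additive] [Pretriangulated CV0]
    [IsTriangulated CV0]
    (j : CV0 ⥤ CV) [j.CommShift ℤ] [j.IsTriangulated] [j.Full] [j.Faithful]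
    -- the triangulated functors ↑ and Φ
    (up : Ck ⥤ CV) [up.CommShift ℤ] [up.IsTriangulated]
    (up0 : C0 ⥤ CV0) [up0.CommShift ℤ] [up0.IsTriangulated]
    (hup : ι ⋙ up ≅ up0 ⋙ j)
    (Φ : CV0 ⥤ Ck) [Φ.CommShift ℤ] [Φ.IsTriangulated]
    -- the natural transformation t of triangulated functors
    (t : 𝟭 CV ⟶ 𝟭 CV)
    (ht : ∀ (n : ℤ) (X : CV), (shiftFunctor CV n).map (t.app X) = t.app (X⟦n⟧))
    -- t restricts to CV0 via the fully faithful embedding j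
    (t0 : 𝟭 CV0 ⟶ 𝟭 CV0)
    (ht0 : ∀ X : CV0, j.map (t0.app X) = t.app (j.obj X))
    -- axiom (i): Φ(t_{M↑}) is a split monomorphism for every M in C0
    (ax1 : ∀ M : C0, ∃ r : Φ.obj (up0.obj M) ⟶ Φ.obj (up0.obj M),
      Φ.map (t0.app (up0.obj M)) ≫ r = 𝟙 (Φ.obj (up0.obj M)))
    -- axiom (ii): Φ(cone(t_{M↑})) ≅ M for every M in C0
    (ax2 : ∀ (M : C0) (Cone : CV0) (g : up0.obj M ⟶ Cone)
      (h : Cone ⟶ (up0.obj M)⟦(1:ℤ)⟧),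
      (Triangle.mk (t0.app (up0.obj M)) g h ∈ distTriang CV0) →
        Nonempty (Φ.obj Cone ≅ ι.obj M))
    -- the categorical degeneration
    (M N : C0) (Q : CV0)
    (hQ : Nonempty ((sigmaT t0).Q.obj Q ≅ (sigmaT t0).Q.obj (up0.obj M)))
    (hcone : ∀ (Cone : CV0) (g : Q ⟶ Cone) (h : Cone ⟶ Q⟦(1:ℤ)⟧),
      (Triangle.mk (t0.app Q) g h ∈ distTriang CV0) →
        Nonempty (Φ.obj Cone ≅ ι.obj N)) :
    ∃ (Z : C0) (v : End Z) (u : Z ⟶ M) (w : Z ⊞ M ⟶ N) (d : N ⟶ Z⟦(1:ℤ)⟧),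
      IsNilpotent v ∧
        (Triangle.mk (biprod.lift (v : Z ⟶ Z) u) w d ∈ distTriang C0) := by
  obtain ⟨φ⟩ := hQ
  obtain ⟨n, g, f, hgf, hfg⟩ := exists_comp_eq_tpow_of_Q_iso t0 φ
  obtain ⟨KA, iA, dA, hA⟩ := distinguished_cocone_triangle (t0.app (up0.obj M))
  obtain ⟨KB, iB, dB, hB⟩ := distinguished_cocone_triangle (t0.app Q)
  obtain ⟨m⟩ := ax2 M KA iA dA hA
  obtain ⟨l⟩ := hcone KB iB dB hB
  obtain ⟨r, hr⟩ := ax1 M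
  have : IsSplitMono (Φ.map (t0.app (up0.obj M))) := ⟨⟨⟨r, hr⟩⟩⟩
  obtain ⟨Z, Y, a, p, q, e, hT, hnil⟩ :=
    exists_biprod_triangle_of_comp_eq_tpow Φ t0 f g hfg hgf hA hB
  exact exists_biprod_lift_triangle_of_fullyFaithful ι m l hT e hnil
end

section
/- Let k be a commutative ring and let T be a skeletally small k-linear triangulated category with split idempotents such that for all objects X, Y of T the k-module Hom_T(X,Y) has finite length, and such that for all objects X, Y there is an integer n = n_{XY} with Hom_T(X,Y[j]) = 0 for all j > n. If M and N are objects of T with M ⪯_Δ N and N ⪯_Δ M, then M ≅ N; consequently ⪯_Δ is a partial order on the set of isomorphism classes of objects of T. -/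
open CategoryTheory Limits Pretriangulated

universe v u w

section DeltaRelation

variable (T : Type u) [Category.{v} T] [Preadditive T] [HasZeroObject T]
  [HasShift T ℤ] [∀ n : ℤ, (shiftFunctor T n).Additive] [Pretriangulated T]

/-- One step of triangle degeneration: `X ≤_Δ Y` in one step when there are an object `Z`
and a distinguished triangle `Z → Z ⊞ X → Y → Z⟦1⟧`. -/
def deltaStep (X Y : T) : Prop :=
  ∃ (Z : T) (v : Z ⟶ Z) (u : Z ⟶ X) (w : Z ⊞ X ⟶ Y) (d : Y ⟶ Z⟦(1:ℤ)⟧),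
    Triangle.mk (biprod.lift v u) w d ∈ distTriang T

/-- `⪯_Δ` : the smallest transitive relation containing `deltaStep`. -/
def deltaLE (X Y : T) : Prop :=
  Relation.TransGen (deltaStep T) X Y

end DeltaRelation

section TrivialIdempotents

/-- In a ring whose only idempotents are `0` and `1`, left invertible elements are units. -/
lemma isUnit_of_mul_eq_one_of_trivial_idempotents {R : Type*} [Ring R]
    (h : ∀ e : R, e * e = e → e = 0 ∨ e = 1) {z a : R} (hza : z * a = 1) : IsUnit a := by
  have hidem : a * z * (a * z) = a * z := by
    rw [mul_assoc, ← mul_assoc z, hza, one_mul]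
  rcases h _ hidem with h0 | h1
  · have ha : a = 0 := by
      calc a = a * z * a := by rw [mul_assoc, hza, mul_one]
        _ = 0 := by rw [h0, zero_mul]
    have h01 : (0 : R) = 1 := by rw [← hza, ha, mul_zero]
    have := subsingleton_of_zero_eq_one h01
    exact isUnit_of_subsingleton a
  · exact ⟨⟨a, z, h1, hza⟩, rfl⟩

/-- Fitting's lemma for finite length algebras: some positive power of any element is
von Neumann regular. -/
lemma exists_pow_mul_mul_pow_eq (k : Type*) [CommRing k] {R : Type*} [Ring R] [Algebra k R]
    (hR : IsFiniteLength k R) (a : R) :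
    ∃ n : ℕ, 0 < n ∧ ∃ r : R, a ^ n * r * a ^ n = a ^ n := by
  obtain ⟨_, _⟩ := isFiniteLength_iff_isNoetherian_isArtinian.mp hR
  obtain ⟨n, hn, hpos⟩ := ((LinearMap.mulLeft k a).eventually_isCompl_ker_pow_range_pow.and
    (Filter.eventually_gt_atTop 0)).exists
  rw [LinearMap.pow_mulLeft] at hn
  refine ⟨n, hpos, ?_⟩
  have h1 : (1 : R) ∈ LinearMap.ker (LinearMap.mulLeft k (a ^ n)) ⊔
      LinearMap.range (LinearMap.mulLeft k (a ^ n)) := by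
    rw [hn.sup_eq_top]; trivial
  obtain ⟨p, hp, q, ⟨r, rfl⟩, hpq⟩ := Submodule.mem_sup.mp h1
  change a ^ n * p = 0 at hp
  change p + a ^ n * r = 1 at hpq
  have hsq : a ^ n * (a ^ n * r) = a ^ n := by
    simpa [mul_add, hp] using congrArg (a ^ n * ·) hpq
  refine ⟨r, ?_⟩
  have hmem : a ^ n * (r * a ^ n - 1) ∈ LinearMap.ker (LinearMap.mulLeft k (a ^ n)) ⊓
      LinearMap.range (LinearMap.mulLeft k (a ^ n)) := by
    refine ⟨?_, ⟨_, rfl⟩⟩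
    change a ^ n * (a ^ n * (r * a ^ n - 1)) = 0
    rw [mul_sub, mul_sub, mul_one, ← mul_assoc (a ^ n) r, ← mul_assoc (a ^ n) (a ^ n * r), hsq,
      sub_self]
  rw [hn.inf_eq_bot, Submodule.mem_bot, mul_sub, mul_one, sub_eq_zero] at hmem
  rw [mul_assoc, hmem]

/-- A finite length algebra whose only idempotents are `0` and `1` satisfies the local
dichotomy. -/
lemma isUnit_or_isUnit_one_sub_of_trivial_idempotents (k : Type*) [CommRing k] {R : Type*} [Ring R]
    [Algebra k R] (hR : IsFiniteLength k R) (h : ∀ e : R, e * e = e → e = 0 ∨ e = 1) (a : R) :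
    IsUnit a ∨ IsUnit (1 - a) := by
  obtain ⟨n, hn, r, hr⟩ := exists_pow_mul_mul_pow_eq k hR a
  have hidem : r * a ^ n * (r * a ^ n) = r * a ^ n := by
    rw [mul_assoc, ← mul_assoc (a ^ n), hr]
  rcases h _ hidem with h0 | h1
  · right
    have ha : a ^ n = 0 := by rw [← hr, mul_assoc, h0, mul_zero]
    exact IsNilpotent.isUnit_one_sub ⟨n, ha⟩
  · left
    exact (isUnit_pow_iff hn.ne').mp (isUnit_of_mul_eq_one_of_trivial_idempotents h h1)

/-- Finite length algebras whose only idempotents are `0` and `1` have stable range one. -/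
lemma exists_isUnit_add_mul_of_trivial_idempotents (k : Type*) [CommRing k] {R : Type*} [Ring R]
    [Algebra k R] (hR : IsFiniteLength k R) (h : ∀ e : R, e * e = e → e = 0 ∨ e = 1)
    {x a y : R} (hxy : x * a + y = 1) : ∃ e : R, IsUnit (a + e * y) := by
  rcases isUnit_or_isUnit_one_sub_of_trivial_idempotents k hR h (x * a) with hu | hu
  · obtain ⟨z, hz⟩ := hu.exists_left_inv
    refine ⟨0, ?_⟩
    rw [zero_mul, add_zero]
    exact isUnit_of_mul_eq_one_of_trivial_idempotents h (z := z * x) (by rw [mul_assoc, hz])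
  · rw [← hxy, add_sub_cancel_left] at hu
    obtain ⟨z, hz⟩ := hu.exists_left_inv
    refine ⟨(1 - a) * z, ?_⟩
    rw [mul_assoc, hz, mul_one, add_sub_cancel]
    exact isUnit_one

end TrivialIdempotents

section Cancellation

variable {C : Type u} [Category.{v} C] [Preadditive C]

/-- The endomorphisms of a proper retract have smaller length. -/
lemma length_end_lt_of_retract (k : Type w) [CommRing k] [CategoryTheory.Linear k C] {Z W : C}
    (hfl : IsFiniteLength k (Z ⟶ Z)) (i : W ⟶ Z) (p : Z ⟶ W) (hip : i ≫ p = 𝟙 W)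
    (hpi : p ≫ i ≠ 𝟙 Z) : Module.length k (W ⟶ W) < Module.length k (Z ⟶ Z) := by
  obtain ⟨_, _⟩ := isFiniteLength_iff_isNoetherian_isArtinian.mp hfl
  let F : (W ⟶ W) →ₗ[k] (Z ⟶ Z) := Linear.leftComp k Z p ∘ₗ Linear.rightComp k W i
  have hF : ∀ g, F g = p ≫ g ≫ i := fun g ↦ by simp [F]
  have hinj : Function.Injective F := by
    intro g g' hg
    rw [hF, hF] at hg
    have := congrArg (fun t ↦ i ≫ t ≫ p) hg
    simpa [hip, reassoc_of% hip] using this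
  rw [(LinearEquiv.ofInjective F hinj).length_eq]
  refine Submodule.length_lt fun htop ↦ hpi ?_
  obtain ⟨g, hg⟩ := LinearMap.range_eq_top.mp htop (𝟙 Z)
  rw [hF] at hg
  calc p ≫ i = 𝟙 Z ≫ p ≫ i := (Category.id_comp _).symm
    _ = 𝟙 Z := by rw [← hg]; simp [reassoc_of% hip]

variable [HasBinaryBiproducts C]

/-- Cancellation of a summand whose endomorphism ring satisfies a stable range condition. -/
lemma nonempty_iso_of_biprod_iso_of_stable_range {Z X Y : C}
    (hZ : ∀ x a y : End Z, x * a + y = 1 → ∃ e : End Z, IsUnit (a + e * y))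
    (φ : Z ⊞ X ≅ Z ⊞ Y) : Nonempty (X ≅ Y) := by
  let a : End Z := biprod.inl ≫ φ.hom ≫ biprod.fst
  let x : End Z := biprod.inl ≫ φ.inv ≫ biprod.fst
  let b : Y ⟶ Z := biprod.inr ≫ φ.inv ≫ biprod.fst
  let c : Z ⟶ Y := biprod.inl ≫ φ.hom ≫ biprod.snd
  let y : End Z := c ≫ b
  have hxy : x * a + y = 1 := by
    have h1 : (biprod.inl : Z ⟶ Z ⊞ X) ≫ φ.hom ≫
        (biprod.fst ≫ biprod.inl + biprod.snd ≫ biprod.inr) ≫ φ.inv ≫ biprod.fst = 𝟙 Z := by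
      rw [biprod.total]; simp
    simpa only [Preadditive.comp_add, Preadditive.add_comp, Category.assoc, End.mul_def,
      End.one_def, x, a, y, b, c] using h1
  obtain ⟨e, he⟩ := hZ x a y hxy
  let ψ : Z ⊞ X ≅ Z ⊞ Y := φ ≪≫ Biprod.unipotentLower (b ≫ e)
  have hψ : biprod.inl ≫ ψ.hom ≫ biprod.fst = a + e * y := by
    simp [ψ, a, b, c, y, End.mul_def, Biprod.ofComponents, Preadditive.comp_add]
  have : IsIso (biprod.inl ≫ ψ.hom ≫ biprod.fst) := by
    rw [hψ]
    exact (isUnit_iff_isIso _).mp he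
  exact ⟨Biprod.isoElim ψ⟩

/-- A split idempotent and its complement decompose an object as a biproduct. -/
noncomputable def isoBiprodOfSplitting {Z Z₁ Z₂ : C} (i₁ : Z₁ ⟶ Z) (p₁ : Z ⟶ Z₁) (i₂ : Z₂ ⟶ Z) (p₂ : Z ⟶ Z₂)
    (h₁ : i₁ ≫ p₁ = 𝟙 _) (h₂ : i₂ ≫ p₂ = 𝟙 _) (h₁₂ : i₁ ≫ p₂ = 0) (h₂₁ : i₂ ≫ p₁ = 0)
    (htot : p₁ ≫ i₁ + p₂ ≫ i₂ = 𝟙 Z) : Z ≅ Z₁ ⊞ Z₂ where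
  hom := biprod.lift p₁ p₂
  inv := biprod.desc i₁ i₂
  hom_inv_id := by simpa using htot
  inv_hom_id := by ext <;> simp [h₁, h₂, h₁₂, h₂₁]

/-- Cancellation in idempotent complete linear categories: summands with finite length
endomorphism algebras can be cancelled. -/
theorem nonempty_iso_of_biprod_iso (k : Type w) [CommRing k] [CategoryTheory.Linear k C]
    [IsIdempotentComplete C] (hfl : ∀ X : C, IsFiniteLength k (X ⟶ X)) (Z : C) {X Y : C}
    (φ : Z ⊞ X ≅ Z ⊞ Y) : Nonempty (X ≅ Y) := by
  induction hl : Module.length k (Z ⟶ Z) using WellFoundedLT.induction generalizing Z X Y with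
  | ind l ih =>
  subst hl
  by_cases h : ∀ e : End Z, e * e = e → e = 0 ∨ e = 1
  · exact nonempty_iso_of_biprod_iso_of_stable_range
      (fun _ _ _ ↦ exists_isUnit_add_mul_of_trivial_idempotents k (hfl Z) h) φ
  · push Not at h
    obtain ⟨e, he, he0, he1⟩ := h
    change Z ⟶ Z at e
    change e ≫ e = e at he
    obtain ⟨Z₁, i₁, p₁, h₁, hp₁⟩ := IsIdempotentComplete.idempotents_split Z e he
    obtain ⟨Z₂, i₂, p₂, h₂, hp₂⟩ := IsIdempotentComplete.idempotents_split Z (𝟙 Z - e)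
      (by simp [Preadditive.comp_sub, Preadditive.sub_comp, he])
    have h₁₂ : i₁ ≫ p₂ = 0 := by
      calc i₁ ≫ p₂ = (i₁ ≫ p₁) ≫ i₁ ≫ p₂ ≫ i₂ ≫ p₂ := by rw [h₁, h₂]; simp
        _ = i₁ ≫ (p₁ ≫ i₁) ≫ (p₂ ≫ i₂) ≫ p₂ := by simp
        _ = i₁ ≫ (e ≫ (𝟙 Z - e)) ≫ p₂ := by rw [hp₁, hp₂]; simp
        _ = 0 := by simp [Preadditive.comp_sub, he]
    have h₂₁ : i₂ ≫ p₁ = 0 := by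
      calc i₂ ≫ p₁ = (i₂ ≫ p₂) ≫ i₂ ≫ p₁ ≫ i₁ ≫ p₁ := by rw [h₁, h₂]; simp
        _ = i₂ ≫ (p₂ ≫ i₂) ≫ (p₁ ≫ i₁) ≫ p₁ := by simp
        _ = i₂ ≫ ((𝟙 Z - e) ≫ e) ≫ p₁ := by rw [hp₁, hp₂]; simp
        _ = 0 := by simp [Preadditive.sub_comp, he]
    let d : Z ≅ Z₁ ⊞ Z₂ := isoBiprodOfSplitting i₁ p₁ i₂ p₂ h₁ h₂ h₁₂ h₂₁ (by rw [hp₁, hp₂]; simp)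
    let D (W : C) : Z ⊞ W ≅ Z₁ ⊞ Z₂ ⊞ W :=
      biprod.mapIso d (Iso.refl W) ≪≫ biprod.associator Z₁ Z₂ W
    obtain ⟨φ₂⟩ := ih _ (length_end_lt_of_retract k (hfl Z) i₁ p₁ h₁ (by rw [hp₁]; exact he1))
      Z₁ ((D X).symm ≪≫ φ ≪≫ D Y) rfl
    refine ih _ (length_end_lt_of_retract k (hfl Z) i₂ p₂ h₂ ?_) Z₂ φ₂ rfl
    rw [hp₂]
    intro h
    exact he0 (by simpa using h)

/-- Lengths of Hom-modules are additive on biproducts. -/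
lemma length_hom_biprod (k : Type w) [CommRing k] [CategoryTheory.Linear k C] (U X Y : C) :
    Module.length k (U ⟶ X ⊞ Y) = Module.length k (U ⟶ X) + Module.length k (U ⟶ Y) := by
  refine Module.length_eq_add_of_exact (Linear.rightComp k U (biprod.inl : X ⟶ X ⊞ Y))
    (Linear.rightComp k U (biprod.snd : X ⊞ Y ⟶ Y)) ?_ ?_ ?_
  · intro f g h
    simpa using congrArg (· ≫ (biprod.fst : X ⊞ Y ⟶ X)) h
  · intro f
    exact ⟨f ≫ biprod.inr, by simp⟩
  · intro f
    constructor
    · intro h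
      refine ⟨f ≫ biprod.fst, ?_⟩
      change f ≫ biprod.snd = 0 at h
      ext <;> simp [h]
    · rintro ⟨g, rfl⟩
      simp

end Cancellation

section HomLength

variable {T : Type u} [Category.{v} T] [Preadditive T] [HasZeroObject T]
  [HasShift T ℤ] [∀ n : ℤ, (shiftFunctor T n).Additive] [Pretriangulated T]

/-- In a distinguished triangle `A → B → Y → A⟦1⟧`, the length of `Hom(U, B)` is at most the
length of `Hom(U, A)` plus the length of the image of `Hom(U, B) → Hom(U, Y)`. -/
lemma length_hom_le_of_distTriang (k : Type w) [CommRing k] [CategoryTheory.Linear k T]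
    {A B Y : T} {f : A ⟶ B} {w : B ⟶ Y} {d : Y ⟶ A⟦(1 : ℤ)⟧}
    (hT : Triangle.mk f w d ∈ distTriang T) (U : T) :
    Module.length k (U ⟶ B) ≤
      Module.length k (U ⟶ A) + Module.length k (LinearMap.range (Linear.rightComp k U w)) := by
  have hker : LinearMap.ker (Linear.rightComp k U w) ≤
      LinearMap.range (Linear.rightComp k U f) := by
    intro g hg
    obtain ⟨h, hh⟩ := Triangle.coyoneda_exact₂ _ hT g hg
    exact ⟨h, hh.symm⟩
  rw [Module.length_eq_add_of_exact (LinearMap.ker (Linear.rightComp k U w)).subtype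
    (Linear.rightComp k U w).rangeRestrict (Submodule.subtype_injective _)
    (LinearMap.surjective_rangeRestrict _) (by
      rw [LinearMap.exact_iff, LinearMap.ker_rangeRestrict, Submodule.range_subtype])]
  gcongr
  exact (Module.length_le_of_injective _ (Submodule.inclusion_injective hker)).trans
    (Module.length_le_of_surjective _ (LinearMap.surjective_rangeRestrict _))

variable (k : Type w) [CommRing k] [CategoryTheory.Linear k T]

lemma deltaStep.length_hom_le_range {X Y Z : T} {v : Z ⟶ Z} {u : Z ⟶ X} {w : Z ⊞ X ⟶ Y}
    {d : Y ⟶ Z⟦(1 : ℤ)⟧} (hfl : ∀ X Y : T, IsFiniteLength k (X ⟶ Y))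
    (hT : Triangle.mk (biprod.lift v u) w d ∈ distTriang T) (U : T) :
    Module.length k (U ⟶ X) ≤ Module.length k (LinearMap.range (Linear.rightComp k U w)) := by
  have h := length_hom_le_of_distTriang k hT U
  rw [length_hom_biprod] at h
  exact (ENat.add_le_add_iff_left (Module.length_ne_top_iff.mpr (hfl U Z))).mp h

lemma deltaStep.length_hom_le (hfl : ∀ X Y : T, IsFiniteLength k (X ⟶ Y)) {X Y : T}
    (h : deltaStep T X Y) (U : T) :
    Module.length k (U ⟶ X) ≤ Module.length k (U ⟶ Y) := by
  obtain ⟨Z, v, u, w, d, hT⟩ := h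
  exact (deltaStep.length_hom_le_range k hfl hT U).trans
    (Module.length_le_of_injective _ (Submodule.subtype_injective _))

lemma deltaLE.length_hom_le (hfl : ∀ X Y : T, IsFiniteLength k (X ⟶ Y)) {X Y : T}
    (h : deltaLE T X Y) (U : T) :
    Module.length k (U ⟶ X) ≤ Module.length k (U ⟶ Y) := by
  induction h with
  | single h => exact h.length_hom_le k hfl U
  | tail _ h ih => exact ih.trans (h.length_hom_le k hfl U)

lemma deltaStep.nonempty_iso [IsIdempotentComplete T]
    (hfl : ∀ X Y : T, IsFiniteLength k (X ⟶ Y)) {X Y : T} (h : deltaStep T X Y)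
    (hle : Module.length k (Y ⟶ Y) ≤ Module.length k (Y ⟶ X)) : Nonempty (X ≅ Y) := by
  obtain ⟨Z, v, u, w, d, hT⟩ := h
  obtain ⟨_, _⟩ := isFiniteLength_iff_isNoetherian_isArtinian.mp (hfl Y Y)
  have htop : LinearMap.range (Linear.rightComp k Y w) = ⊤ := by
    by_contra hne
    exact (Submodule.length_lt hne).not_ge
      (hle.trans (deltaStep.length_hom_le_range k hfl hT Y))
  obtain ⟨s, hs⟩ := LinearMap.range_eq_top.mp htop (𝟙 Y)
  change s ≫ w = 𝟙 Y at hs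
  have hwd : w ≫ d = 0 := comp_distTriang_mor_zero₂₃ _ hT
  have hd : d = 0 := by rw [← Category.id_comp d, ← hs, Category.assoc, hwd, comp_zero]
  obtain ⟨φ, -, -⟩ := exists_iso_binaryBiproduct_of_distTriang _ hT hd
  exact nonempty_iso_of_biprod_iso k (fun X ↦ hfl X X) Z φ

lemma deltaLE.nonempty_iso [IsIdempotentComplete T]
    (hfl : ∀ X Y : T, IsFiniteLength k (X ⟶ Y)) {X Y : T} (h : deltaLE T X Y)
    (hle : ∀ U : T, Module.length k (U ⟶ Y) ≤ Module.length k (U ⟶ X)) : Nonempty (X ≅ Y) := by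
  induction h with
  | single h => exact h.nonempty_iso k hfl (hle _)
  | tail hXZ hZY ih =>
    obtain ⟨α⟩ := ih fun U ↦ (hZY.length_hom_le k hfl U).trans (hle U)
    obtain ⟨β⟩ := hZY.nonempty_iso k hfl ((hle _).trans (deltaLE.length_hom_le k hfl hXZ _))
    exact ⟨α ≪≫ β⟩

end HomLength

/-- Let `k` be a commutative ring and `T` a skeletally small `k`-linear
triangulated category with split idempotents such that all Hom-spaces `Hom_T(X,Y)` have
finite length over `k`, and such that for all `X, Y` there is `n` with `Hom_T(X,Y[j]) = 0`
for all `j > n`. If `M ⪯_Δ N` and `N ⪯_Δ M` then `M ≅ N`; consequently `⪯_Δ` is a partial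
order on the set of isomorphism classes of objects of `T`. -/
theorem stmt_4 (k : Type w) [CommRing k]
    (T : Type u) [Category.{v} T] [Preadditive T] [HasZeroObject T]
    [HasShift T ℤ] [∀ n : ℤ, (shiftFunctor T n).Additive] [Pretriangulated T]
    [IsTriangulated T] [CategoryTheory.Linear k T] [IsIdempotentComplete T]
    [EssentiallySmall.{v} T]
    (hfl : ∀ X Y : T, IsFiniteLength k (X ⟶ Y))
    (hvanish : ∀ X Y : T, ∃ n : ℤ, ∀ j > n, ∀ f : X ⟶ Y⟦j⟧, f = 0)
    (M N : T) (hMN : deltaLE T M N) (hNM : deltaLE T N M) :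
    Nonempty (M ≅ N) := by
  exact deltaLE.nonempty_iso k hfl hMN fun U ↦ deltaLE.length_hom_le k hfl hNM U
end

section
/- Let k be a commutative Noetherian ring and let T be a skeletally small k-linear triangulated category with split idempotents such that for all objects X, Y of T the k-module Hom_T(X,Y) is finitely generated, and such that for all objects X, Y there is an integer n = n_{XY} with Hom_T(X,Y[j]) = 0 for all j > n. If M and N are objects of T with M ⪯_Δ N and N ⪯_Δ M, then there exists an object Z of T such that M ⊕ Z and N ⊕ Z are isomorphic. -/
open CategoryTheory Limits Pretriangulated

universe v u w

section Algebra

theorem exists_pow_eq_pow_smul_of_isNilpotent_sub {k R : Type*} [CommRing k] [Ring R] [Algebra k R]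
    {θ : R} {a : k} (h : IsNilpotent (θ - algebraMap k R a)) (p : ℕ) :
    ∃ (m : ℕ) (c : R), θ ^ m = a ^ p • c := by
  induction p with
  | zero => exact ⟨0, 1, by simp⟩
  | succ p ih =>
    obtain ⟨m, c, hc⟩ := ih
    obtain ⟨n, hn⟩ := h
    have hcomm : Commute θ (θ - algebraMap k R a) :=
      (Commute.refl θ).sub_right (Algebra.commutes a θ).symm
    have hgeom := hcomm.mul_geom_sum₂ n
    rw [hn, sub_zero, sub_sub_cancel, ← Algebra.smul_def] at hgeom
    exact ⟨m + n, c * _, by rw [pow_add, hc, ← hgeom, pow_succ, smul_mul_smul_comm]⟩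

theorem exists_isIdempotentElem_mul_of_forall_exists_mul_eq {R : Type*} [Ring R] {ψ : R}
    (hψ : ∀ r, Commute ψ r) (h : ∀ r, ∃ e, ψ * r = r * e * r) :
    ∃ ε, IsIdempotentElem (ψ * ε) ∧ ψ ^ 3 * (ψ * ε) = ψ ^ 3 := by
  obtain ⟨e, he⟩ := h (ψ ^ 2)
  have h1 : ψ ^ 3 * (ψ * e) = ψ ^ 3 := by
    have h2 : ψ ^ 2 * e * ψ ^ 2 = ψ ^ 3 * (ψ * e) := by
      rw [mul_assoc, ← ((hψ e).pow_left 2).eq]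
      noncomm_ring
    rw [← h2, ← he]
    noncomm_ring
  have hpow (n : ℕ) : ψ ^ 3 * (ψ * e) ^ n = ψ ^ 3 := by
    induction n with
    | zero => simp
    | succ n ih => rw [pow_succ (ψ * e), ← mul_assoc, ih, h1]
  have h3 : ψ * (ψ ^ 2 * e ^ 3) = (ψ * e) ^ 3 := by
    rw [(hψ e).mul_pow]
    noncomm_ring
  refine ⟨ψ ^ 2 * e ^ 3, ?_, ?_⟩
  · rw [h3, IsIdempotentElem]
    nth_rw 1 [(hψ e).mul_pow]
    rw [((hψ e).pow_pow 3 3).eq, mul_assoc, hpow, ← ((hψ e).pow_pow 3 3).eq, (hψ e).mul_pow]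
  · rw [h3, hpow]

theorem exists_smul_one_eq_sq_mul_smul_one {k R : Type*} [CommRing k] [Ring R] [Algebra k R]
    [Module.Finite k R] {y : k} {e : R} (h : y • (1 : R) = y ^ 2 • e) :
    ∃ b : k, (y - y ^ 2 * b) • (1 : R) = 0 := by
  let N : Submodule k R := LinearMap.range (LinearMap.lsmul k R y)
  have hfg : N.FG := by
    rw [show N = Submodule.map (LinearMap.lsmul k R y) ⊤ from LinearMap.range_eq_map _]
    exact Module.Finite.fg_top.map _
  have hle : N ≤ Ideal.span {y} • N := by
    rintro _ ⟨r, rfl⟩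
    have : y • r = y • (y • (e * r)) := by
      rw [← one_mul r, ← smul_mul_assoc, h, smul_mul_assoc, smul_smul, one_mul, pow_two]
    rw [LinearMap.lsmul_apply, this]
    exact Submodule.smul_mem_smul (Ideal.mem_span_singleton_self y) ⟨_, rfl⟩
  obtain ⟨t, ht, ht'⟩ := Submodule.exists_sub_one_mem_and_smul_eq_zero_of_fg_of_le_smul _ N hfg hle
  obtain ⟨c, hc⟩ := Ideal.mem_span_singleton'.mp ht
  refine ⟨-c, ?_⟩
  have := ht' (y • 1) ⟨1, rfl⟩
  rw [smul_smul] at this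
  rw [← this]
  congr 1
  linear_combination y * hc

theorem isArtinianRing_quotient_of_forall_isPrime {k : Type*} [CommRing k] [IsNoetherianRing k]
    (I : Ideal k) (h : ∀ Q : Ideal k, Q.IsPrime → I ≤ Q → Q.IsMaximal) :
    IsArtinianRing (k ⧸ I) := by
  have : Ring.KrullDimLE 0 (k ⧸ I) := by
    refine Ring.KrullDimLE.mk₀ fun Q hQ => ?_
    have hmax := h (Q.comap (Ideal.Quotient.mk I)) (hQ.comap _) (by
      intro x hx
      simp [Ideal.mem_comap, Ideal.Quotient.eq_zero_iff_mem.mpr hx])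
    have := Ideal.map_eq_top_or_isMaximal_of_surjective (Ideal.Quotient.mk I)
      Ideal.Quotient.mk_surjective hmax
    rw [Ideal.map_comap_of_surjective _ Ideal.Quotient.mk_surjective] at this
    exact this.resolve_left hQ.ne_top
  exact isArtinianRing_iff_isNoetherianRing_krullDimLE_zero.mpr ⟨inferInstance, this⟩

theorem isArtinian_of_isArtinianRing_quotient {k : Type*} [CommRing k] (M : Type*)
    [AddCommGroup M] [Module k M] [Module.Finite k M] (I : Ideal k) [IsArtinianRing (k ⧸ I)]
    (h : ∀ a ∈ I, ∀ m : M, a • m = 0) : IsArtinian k M := by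
  have hI : Module.IsTorsionBySet k M I := fun m a => h a a.2 m
  let := hI.module
  have : IsScalarTower k (k ⧸ I) M := hI.isScalarTower (S := k)
  have : Module.Finite (k ⧸ I) M := Module.Finite.of_restrictScalars_finite k _ _
  have : IsArtinian (k ⧸ I) M := inferInstance
  exact isArtinian_of_surjective_algebraMap (R := k ⧸ I) Ideal.Quotient.mk_surjective

end Algebra

theorem algebraMap_end {k : Type w} [CommRing k] {T : Type u} [Category.{v} T] [Preadditive T]
    [CategoryTheory.Linear k T] (a : k) (U : T) : algebraMap k (End U) a = a • 𝟙 U :=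
  Algebra.algebraMap_eq_smul_one a

section Twist

variable {k : Type w} [CommRing k] {T : Type u} [Category.{v} T] [Preadditive T]
  [HasShift T ℤ] [CategoryTheory.Linear k T]

/-- The endomorphism of `U` whose shift is multiplication by `a` on `U⟦1⟧`. Since the shift is not
assumed to be `k`-linear, it may differ from multiplication by `a` on `U`. -/
noncomputable def shiftTwist (a : k) (U : T) : End U :=
  (shiftFunctor T (1 : ℤ)).preimage (a • 𝟙 (U⟦(1 : ℤ)⟧))

/-- The difference between `shiftTwist a U` and multiplication by `a` on `U`. -/
noncomputable def twistDefect (a : k) (U : T) : End U :=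
  shiftTwist a U - algebraMap k (End U) a

@[simp]
theorem map_shiftTwist (a : k) (U : T) :
    (shiftFunctor T (1 : ℤ)).map (shiftTwist a U) = a • 𝟙 (U⟦(1 : ℤ)⟧) :=
  (shiftFunctor T (1 : ℤ)).map_preimage _

theorem shiftTwist_naturality (a : k) {U V : T} (f : U ⟶ V) :
    f ≫ shiftTwist a V = shiftTwist a U ≫ f := by
  apply (shiftFunctor T (1 : ℤ)).map_injective
  simp only [Functor.map_comp, map_shiftTwist]
  simp

theorem twistDefect_naturality (a : k) {U V : T} (f : U ⟶ V) :
    f ≫ twistDefect a V = twistDefect a U ≫ f := by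
  have := shiftTwist_naturality a f
  rw [twistDefect, twistDefect, algebraMap_end, algebraMap_end]
  change f ≫ (End.asHom (shiftTwist a V) - a • 𝟙 V) = (End.asHom (shiftTwist a U) - a • 𝟙 U) ≫ f
  simpa using this

theorem twistDefect_pow_naturality (a : k) {U V : T} (f : U ⟶ V) (n : ℕ) :
    f ≫ (twistDefect a V ^ n : End V) = (twistDefect a U ^ n : End U) ≫ f := by
  induction n with
  | zero => exact (Category.comp_id f).trans (Category.id_comp f).symm
  | succ n ih =>
    rw [pow_succ, pow_succ, End.mul_def, End.mul_def, ← Category.assoc, twistDefect_naturality,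
      Category.assoc, ih, Category.assoc]

theorem commute_twistDefect (a : k) {U : T} (f : End U) : Commute (twistDefect a U) f := by
  rw [Commute, SemiconjBy, End.mul_def, End.mul_def, twistDefect_naturality]

theorem map_shiftTwist_pow (a : k) (U : T) (n : ℕ) :
    (shiftFunctor T (1 : ℤ)).map (shiftTwist a U ^ n : End U) = a ^ n • 𝟙 (U⟦(1 : ℤ)⟧) := by
  induction n with
  | zero => simp
  | succ n ih =>
    rw [pow_succ, End.mul_def, Functor.map_comp, ih, map_shiftTwist]
    simp [smul_smul, pow_succ]

end Twist

section Triangulated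

variable {k : Type w} [CommRing k]
  {T : Type u} [Category.{v} T] [Preadditive T] [HasZeroObject T]
  [HasShift T ℤ] [∀ n : ℤ, (shiftFunctor T n).Additive] [Pretriangulated T]
  [CategoryTheory.Linear k T]

theorem exists_twistDefect_mul_eq (a : k) (U : T) (f : End U) :
    ∃ e : End U, twistDefect a U * f = f * e * f := by
  obtain ⟨B, i, p, hT⟩ := distinguished_cocone_triangle₂ ((shiftFunctor T (1 : ℤ)).map f)
  obtain ⟨c, hc₁, hc₂⟩ : ∃ c : U⟦(1 : ℤ)⟧ ⟶ U⟦(1 : ℤ)⟧, p ≫ c = (a • 𝟙 B) ≫ p ∧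
      (shiftFunctor T (1 : ℤ)).map f ≫ (shiftFunctor T (1 : ℤ)).map (a • 𝟙 U) =
        c ≫ (shiftFunctor T (1 : ℤ)).map f :=
    complete_distinguished_triangle_morphism _ _ hT hT (a • 𝟙 U) (a • 𝟙 B)
      (show i ≫ (a • 𝟙 B) = (a • 𝟙 U) ≫ i by simp)
  obtain ⟨e, he⟩ : ∃ e : U⟦(1 : ℤ)⟧ ⟶ U⟦(1 : ℤ)⟧,
      a • 𝟙 _ - c = (shiftFunctor T (1 : ℤ)).map f ≫ e :=
    Triangle.yoneda_exact₃ _ hT (a • 𝟙 (U⟦(1 : ℤ)⟧) - c)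
      (show p ≫ (a • 𝟙 (U⟦(1 : ℤ)⟧) - c) = 0 by simp [hc₁])
  refine ⟨(shiftFunctor T (1 : ℤ)).preimage e, ?_⟩
  apply (shiftFunctor T (1 : ℤ)).map_injective
  rw [End.mul_def, End.mul_def, End.mul_def, Functor.map_comp, Functor.map_comp, Functor.map_comp,
    Functor.map_preimage, ← Category.assoc, ← he]
  change _ ≫ (shiftFunctor T (1 : ℤ)).map (End.asHom (shiftTwist a U) - a • 𝟙 U) = _
  rw [Functor.map_sub, Preadditive.sub_comp, ← hc₂, Preadditive.comp_sub]
  simp [End.asHom]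

theorem exists_pow_smul_id_eq_zero_of_distTriang {U V : T} {z : U ⟶ U} {g : U ⟶ V}
    {δ : V ⟶ U⟦(1 : ℤ)⟧} (hT : Triangle.mk z g δ ∈ distTriang T) {a : k}
    (ha : IsNilpotent (twistDefect a U)) {p : ℕ} (hg : a ^ p • g = 0)
    (hδ : δ ≫ (shiftFunctor T (1 : ℤ)).map (a ^ p • 𝟙 U) = 0) :
    ∃ n : ℕ, a ^ n • 𝟙 V = 0 := by
  obtain ⟨m, c, hc⟩ := exists_pow_eq_pow_smul_of_isNilpotent_sub ha p
  have hc' : (shiftTwist a U ^ m : End U) = (a ^ p • 𝟙 U) ≫ c :=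
    hc.trans (by simp)
  have hδ' : a ^ m • δ = 0 := by
    have : a ^ m • δ = δ ≫ (a ^ m • 𝟙 _) := by simp
    rw [this, ← map_shiftTwist_pow, hc', Functor.map_comp, ← Category.assoc, hδ, zero_comp]
  obtain ⟨t, ht⟩ : ∃ t : U⟦(1 : ℤ)⟧ ⟶ V, a ^ p • 𝟙 V = δ ≫ t :=
    Triangle.yoneda_exact₃ _ hT (a ^ p • 𝟙 V) (show g ≫ (a ^ p • 𝟙 V) = 0 by simpa using hg)
  refine ⟨m + p, ?_⟩
  rw [pow_add, mul_smul, ht, ← Linear.smul_comp, hδ', zero_comp]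

theorem length_add_length_ker_le [IsNoetherianRing k] (hfg : ∀ X Y : T, Module.Finite k (X ⟶ Y))
    {X Y Z : T} {i : Z ⟶ Z ⊞ X} {p : Z ⊞ X ⟶ Y} {d : Y ⟶ Z⟦(1 : ℤ)⟧}
    (hT : Triangle.mk i p d ∈ distTriang T) (V : T) [hV : ∀ A : T, IsArtinian k (A ⟶ V)] :
    Module.length k (X ⟶ V) + Module.length k (LinearMap.ker (Linear.leftComp k V p)) ≤
      Module.length k (Y ⟶ V) := by
  have hker : LinearMap.range (Linear.leftComp k V p) = LinearMap.ker (Linear.leftComp k V i) := by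
    ext f
    constructor
    · rintro ⟨g, rfl⟩
      have : i ≫ p = 0 := comp_distTriang_mor_zero₁₂ _ hT
      simp [reassoc_of% this]
    · intro hf
      obtain ⟨g, hg⟩ := Triangle.yoneda_exact₂ _ hT f hf
      exact ⟨g, hg.symm⟩
  have length_eq {A B : T} (q : A ⟶ B) : Module.length k (B ⟶ V) =
      Module.length k (LinearMap.ker (Linear.leftComp k V q)) +
        Module.length k (LinearMap.range (Linear.leftComp k V q)) :=
    Module.length_eq_add_of_exact (LinearMap.ker _).subtype (Linear.leftComp k V q).rangeRestrict
      Subtype.val_injective (LinearMap.surjective_rangeRestrict _)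
      (LinearMap.exact_iff.mpr (by simp))
  have hsum : Module.length k (Z ⊞ X ⟶ V) =
      Module.length k (X ⟶ V) + Module.length k (Z ⟶ V) := by
    refine Module.length_eq_add_of_exact (Linear.leftComp k V biprod.snd)
      (Linear.leftComp k V biprod.inl) ?_ ?_ ?_
    · intro f g hfg
      simpa [cancel_epi] using hfg
    · exact fun f => ⟨biprod.desc f 0, by simp⟩
    · intro f
      constructor
      · intro hf
        refine ⟨biprod.inr ≫ f, ?_⟩
        apply biprod.hom_ext'
        · simpa using Eq.symm hf
        · simp
      · rintro ⟨g, rfl⟩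
        simp
  have hrange : Module.length k (LinearMap.range (Linear.leftComp k V i)) ≤
      Module.length k (Z ⟶ V) :=
    Module.length_le_of_injective (Submodule.subtype _) Subtype.val_injective
  have hZ : Module.length k (Z ⟶ V) ≠ ⊤ := Module.length_ne_top
  rw [length_eq p, hker, add_comm]
  gcongr
  have := length_eq i
  rw [hsum] at this
  refine (ENat.add_le_add_iff_right hZ).mp ?_
  rw [this]
  gcongr

end Triangulated

section ArtinianObjects

variable {k : Type w} [CommRing k] {T : Type u} [Category.{v} T] [Preadditive T]
  [CategoryTheory.Linear k T]

theorem mem_annihilator_end_iff {a : k} {V : T} :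
    a ∈ Module.annihilator k (V ⟶ V) ↔ a • 𝟙 V = 0 := by
  rw [Module.mem_annihilator]
  refine ⟨fun h => h _, fun h f => ?_⟩
  rw [← Category.comp_id f, ← Linear.comp_smul, h, comp_zero]

variable (k) in
/-- `k` acts on the object `V` through an Artinian quotient ring. -/
def IsArtinianObject (V : T) : Prop :=
  IsArtinianRing (k ⧸ Module.annihilator k (V ⟶ V))

theorem IsArtinianObject.isArtinian_hom {V : T} (hV : IsArtinianObject k V)
    (hfg : ∀ X Y : T, Module.Finite k (X ⟶ Y)) (A : T) : IsArtinian k (A ⟶ V) := by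
  have : IsArtinianRing (k ⧸ Module.annihilator k (V ⟶ V)) := hV
  refine isArtinian_of_isArtinianRing_quotient _ (Module.annihilator k (V ⟶ V)) fun a ha f => ?_
  rw [← Category.comp_id f, ← Linear.comp_smul, mem_annihilator_end_iff.mp ha, comp_zero]

end ArtinianObjects

section Retracts

variable {k : Type w} [CommRing k] {T : Type u} [Category.{v} T] [Preadditive T]
  [HasShift T ℤ] [CategoryTheory.Linear k T]

theorem twistDefect_pow_eq_zero_of_retract {a : k} {U V : T} {s : V ⟶ U} {r : U ⟶ V}
    (hsr : s ≫ r = 𝟙 V) {n : ℕ} (h : s ≫ (twistDefect a U ^ n : End U) = 0) :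
    (twistDefect a V ^ n : End V) = 0 := by
  have : (twistDefect a V ^ n : End V) ≫ s ≫ r = 0 := by
    rw [← Category.assoc, ← twistDefect_pow_naturality, h, zero_comp]
  rw [hsr] at this
  exact (Category.comp_id _).symm.trans this

theorem isNilpotent_twistDefect_of_retract {a : k} {U V : T} {s : V ⟶ U} {r : U ⟶ V}
    (hsr : s ≫ r = 𝟙 V) (h : IsNilpotent (twistDefect a U)) : IsNilpotent (twistDefect a V) := by
  obtain ⟨n, hn⟩ := h
  refine ⟨n, twistDefect_pow_eq_zero_of_retract hsr ?_⟩
  rw [hn]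
  exact comp_zero

end Retracts

section ArtinianTest

variable {k : Type w} [CommRing k] [IsNoetherianRing k]
  {T : Type u} [Category.{v} T] [Preadditive T] [HasZeroObject T]
  [HasShift T ℤ] [∀ n : ℤ, (shiftFunctor T n).Additive] [Pretriangulated T]
  [CategoryTheory.Linear k T] [IsIdempotentComplete T]

/-- Splitting off a direct summand on which `k` acts through an Artinian quotient, one may assume
that the two actions of `x` agree up to a nilpotent. -/
theorem exists_retract_isNilpotent_twistDefect (hfg : ∀ X Y : T, Module.Finite k (X ⟶ Y))
    (x : k) (U : T) :
    ∃ (U' : T) (s : U' ⟶ U) (r : U ⟶ U') (U₁ : T) (s₁ : U₁ ⟶ U) (r₁ : U ⟶ U₁),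
      s ≫ r = 𝟙 U' ∧ r ≫ s = 𝟙 U - r₁ ≫ s₁ ∧ IsArtinianObject k U₁ ∧
        IsNilpotent (twistDefect x U') := by
  obtain ⟨ε, hidem, hε⟩ := exists_isIdempotentElem_mul_of_forall_exists_mul_eq
    (commute_twistDefect x (U := U)) (exists_twistDefect_mul_eq x U)
  let π : U ⟶ U := twistDefect x U * ε
  have hπ : π ≫ π = π := hidem
  obtain ⟨U₁, s₁, r₁, hsr₁, hrs₁⟩ := IsIdempotentComplete.idempotents_split U π hπ
  obtain ⟨U', s, r, hsr, hrs⟩ := IsIdempotentComplete.idempotents_split U (𝟙 U - π)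
    (by simp [hπ])
  refine ⟨U', s, r, U₁, s₁, r₁, hsr, by rw [hrs, hrs₁], ?_, 3, ?_⟩
  · refine isArtinianRing_quotient_of_forall_isPrime _ fun Q hQ hle => ?_
    rw [Ideal.isMaximal_iff]
    refine ⟨(Ideal.ne_top_iff_one Q).mp hQ.ne_top, fun J y hQJ hyQ hyJ => ?_⟩
    obtain ⟨e, he⟩ := exists_twistDefect_mul_eq x U (algebraMap k (End U) y)
    have hid : 𝟙 U₁ = s₁ ≫ π ≫ r₁ := by rw [← hrs₁]; simp [hsr₁]
    have hπy : y • π = y ^ 2 • (e * ε : End U) := by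
      have h1 : y • π = (twistDefect x U * algebraMap k (End U) y) * ε := by
        rw [mul_assoc, Algebra.left_comm, ← Algebra.smul_def]
      rw [h1, he, mul_assoc, mul_assoc, Algebra.left_comm, ← Algebra.smul_def,
        ← Algebra.smul_def, smul_smul, pow_two]
    have hy : y • (1 : End U₁) = y ^ 2 • (s₁ ≫ (e * ε : End U) ≫ r₁ : End U₁) := by
      change y • 𝟙 U₁ = _
      rw [hid, ← Linear.comp_smul, ← Linear.smul_comp, hπy, Linear.smul_comp, Linear.comp_smul]
    have : Module.Finite k (End U₁) := hfg U₁ U₁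
    obtain ⟨b, hb⟩ := exists_smul_one_eq_sq_mul_smul_one hy
    have hmem : y * (1 - y * b) ∈ Q := by
      convert hle (mem_annihilator_end_iff.mpr hb) using 1
      ring
    have hone := hQJ ((hQ.mem_or_mem hmem).resolve_left hyQ)
    simpa using J.add_mem hone (J.mul_mem_right b hyJ)
  · refine twistDefect_pow_eq_zero_of_retract hsr ?_
    have hs : s = s ≫ (𝟙 U - π) := by rw [← hrs]; simp [reassoc_of% hsr]
    have hz : (𝟙 U - π) ≫ (twistDefect x U ^ 3 : End U) = 0 := by
      change twistDefect x U ^ 3 * (1 - twistDefect x U * ε) = 0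
      rw [mul_sub, hε, mul_one, sub_self]
    rw [hs, Category.assoc, hz, comp_zero]

theorem exists_retract_forall_isNilpotent_twistDefect (hfg : ∀ X Y : T, Module.Finite k (X ⟶ Y))
    {Y W : T} {d : Y ⟶ W} (hd : ∀ V : T, IsArtinianObject k V → ∀ f : W ⟶ V, d ≫ f = 0)
    {U : T} (f : W ⟶ U) (S : Finset k) :
    ∃ (U' : T) (s : U' ⟶ U) (r : U ⟶ U'), s ≫ r = 𝟙 U' ∧ d ≫ f ≫ r ≫ s = d ≫ f ∧
      ∀ x ∈ S, IsNilpotent (twistDefect x U') := by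
  classical
  induction S using Finset.induction_on with
  | empty => exact ⟨U, 𝟙 U, 𝟙 U, by simp, by simp, by simp⟩
  | insert x S _ ih =>
    obtain ⟨U', s, r, hsr, hf, hS⟩ := ih
    obtain ⟨U'', s', r', U₁, s₁, r₁, hsr', hrs', hU₁, hx⟩ :=
      exists_retract_isNilpotent_twistDefect hfg x U'
    refine ⟨U'', s' ≫ s, r ≫ r', by simp [reassoc_of% hsr, hsr'], ?_, ?_⟩
    · have h₁ : d ≫ f ≫ r ≫ r₁ = 0 := hd U₁ hU₁ (f ≫ r ≫ r₁)
      rw [Category.assoc, ← Category.assoc r', hrs']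
      simp [reassoc_of% h₁, hf]
    · intro y hy
      rcases Finset.mem_insert.mp hy with rfl | hy
      · exact hx
      · exact isNilpotent_twistDefect_of_retract hsr' (hS y hy)

theorem eq_zero_of_forall_isArtinianObject (hfg : ∀ X Y : T, Module.Finite k (X ⟶ Y))
    {Y W : T} {d : Y ⟶ W} (hd : ∀ V : T, IsArtinianObject k V → ∀ f : W ⟶ V, d ≫ f = 0) :
    d = 0 := by
  by_contra hne
  let J (U : T) : Ideal k := (Module.annihilator k (U ⟶ U)).radical
  have mem_J {U : T} {a : k} : a ∈ J U ↔ ∃ n : ℕ, a ^ n • 𝟙 U = 0 := by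
    simp only [J, Ideal.mem_radical_iff, mem_annihilator_end_iff]
  obtain ⟨_, ⟨U, f₀, hf₀, rfl⟩, hmax⟩ := set_has_maximal_iff_noetherian.mpr ‹IsNoetherianRing k›
    {I | ∃ (U : T) (f : W ⟶ U), d ≫ f ≠ 0 ∧ I = J U} ⟨_, W, 𝟙 W, by simpa using hne, rfl⟩
  replace hmax {V : T} (f : W ⟶ V) (hf : d ≫ f ≠ 0) : ¬ J U < J V := hmax _ ⟨V, f, hf, rfl⟩
  obtain ⟨f, hP⟩ : ∃ f : W ⟶ U, (Ideal.torsionOf k (Y ⟶ U) (d ≫ f)).IsPrime := by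
    obtain ⟨_, ⟨f, hf, rfl⟩, hmaxf⟩ := set_has_maximal_iff_noetherian.mpr ‹IsNoetherianRing k›
      {I | ∃ f : W ⟶ U, d ≫ f ≠ 0 ∧ I = Ideal.torsionOf k (Y ⟶ U) (d ≫ f)} ⟨_, f₀, hf₀, rfl⟩
    refine ⟨f, (Ideal.ne_top_iff_one _).mpr (by simpa [Ideal.mem_torsionOf_iff] using hf),
      fun {a b} hab => ?_⟩
    by_contra! hnot
    simp only [Ideal.mem_torsionOf_iff] at hab hnot
    refine hmaxf _ ⟨b • f, by simpa using hnot.2, rfl⟩ (SetLike.lt_iff_le_and_exists.mpr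
      ⟨fun c hc => ?_, a, ?_, by simpa [Ideal.mem_torsionOf_iff] using hnot.1⟩)
    · rw [Ideal.mem_torsionOf_iff] at hc ⊢
      rw [Linear.comp_smul, smul_comm, hc, smul_zero]
    · rw [Ideal.mem_torsionOf_iff, Linear.comp_smul, smul_smul, hab]
  set P := Ideal.torsionOf k (Y ⟶ U) (d ≫ f) with hP_def
  have mem_P {a : k} : a ∈ P ↔ a • (d ≫ f) = 0 := Ideal.mem_torsionOf_iff _ _
  have hdf : d ≫ f ≠ 0 := fun h => (Ideal.ne_top_iff_one P).mp hP.ne_top (mem_P.mpr (by simp [h]))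
  have hJP : J U ≤ P := hP.radical_le_iff.mpr fun a ha => mem_P.mpr <| by
    rw [← Linear.comp_smul, ← Category.comp_id f, ← Linear.comp_smul,
      mem_annihilator_end_iff.mp ha, comp_zero, comp_zero]
  have key (x : k) (hx : x ∉ J U) : ∃ a, 1 - a * x ∈ P := by
    classical
    obtain ⟨S, hS⟩ := IsNoetherian.noetherian (J U)
    obtain ⟨U', s, r, hsr, hf', hnil⟩ :=
      exists_retract_forall_isNilpotent_twistDefect hfg hd f (insert x S)
    have hdiv (n : ℕ) : ∃ h : Y ⟶ U', d ≫ f ≫ r = x ^ n • h := by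
      obtain ⟨V, g, δ, hT⟩ := distinguished_cocone_triangle (x ^ n • 𝟙 U')
      have hg : x ^ n • g = 0 := by
        have : (x ^ n • 𝟙 U') ≫ g = 0 := comp_distTriang_mor_zero₁₂ _ hT
        simpa using this
      have hzero : d ≫ (f ≫ r) ≫ g = 0 := by
        rw [Category.assoc]
        by_contra hnz
        refine hmax (f ≫ r ≫ g) hnz (SetLike.lt_iff_le_and_exists.mpr ⟨?_, x, ?_, hx⟩)
        · rw [← hS, Submodule.span_le]
          intro a ha
          obtain ⟨p, hp⟩ := mem_J.mp (hS ▸ Submodule.subset_span ha : a ∈ J U)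
          have hp' : a ^ p • 𝟙 U' = 0 := by
            rw [← hsr, ← Category.id_comp r, ← Linear.comp_smul, ← Linear.smul_comp, hp,
              zero_comp, comp_zero]
          refine mem_J.mpr (exists_pow_smul_id_eq_zero_of_distTriang hT
            (hnil a (Finset.mem_insert_of_mem ha)) (p := p) ?_ ?_)
          · rw [← Category.id_comp g, ← Linear.smul_comp, hp', zero_comp]
          · rw [hp', Functor.map_zero, comp_zero]
        · exact mem_J.mpr (exists_pow_smul_id_eq_zero_of_distTriang hT
            (hnil x (Finset.mem_insert_self x S)) hg (comp_distTriang_mor_zero₃₁ _ hT))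
      obtain ⟨h, hh⟩ : ∃ h : Y ⟶ U', d ≫ f ≫ r = h ≫ (x ^ n • 𝟙 U') :=
        Triangle.coyoneda_exact₂ _ hT (d ≫ f ≫ r)
          (show (d ≫ f ≫ r) ≫ g = 0 by simpa using hzero)
      exact ⟨h, by simpa using hh⟩
    have := hfg Y U'
    obtain ⟨⟨t, ht⟩, hmul⟩ := (Ideal.mem_iInf_smul_pow_eq_bot_iff (Ideal.span {x})
      (d ≫ f ≫ r)).mp (by
        rw [Submodule.mem_iInf]
        intro n
        obtain ⟨h, hh⟩ := hdiv n
        rw [hh]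
        exact Submodule.smul_mem_smul
          (Ideal.pow_mem_pow (Ideal.mem_span_singleton_self x) n) trivial)
    obtain ⟨a, rfl⟩ := Ideal.mem_span_singleton'.mp ht
    refine ⟨a, mem_P.mpr ?_⟩
    have h0 : (1 - a * x) • (d ≫ f ≫ r) = 0 := by
      rw [sub_smul, one_smul, hmul, sub_self]
    have h1 := congrArg (· ≫ s) h0
    simpa [hf'] using h1
  have hPJ : P ≤ J U := fun x hx => by
    by_contra hxJ
    obtain ⟨a, ha⟩ := key x hxJ
    exact (Ideal.ne_top_iff_one P).mp hP.ne_top (by simpa using P.add_mem ha (P.mul_mem_left a hx))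
  have hPmax : P.IsMaximal := by
    rw [Ideal.isMaximal_iff]
    refine ⟨(Ideal.ne_top_iff_one P).mp hP.ne_top, fun I x hPI hxP hxI => ?_⟩
    obtain ⟨a, ha⟩ := key x fun h => hxP (hJP h)
    simpa using I.add_mem (hPI ha) (I.mul_mem_left a hxI)
  refine hdf (hd U (isArtinianRing_quotient_of_forall_isPrime _ fun Q hQ hle => ?_) f)
  rwa [← hPmax.eq_of_le hQ.ne_top (hPJ.trans (hQ.radical_le_iff.mpr hle))]

end ArtinianTest

section StableIsomorphism

variable {T : Type u} [Category.{v} T] [Preadditive T] [HasBinaryBiproducts T]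

theorem nonempty_biprod_iso_trans {A B C Z Z' : T} (h : Nonempty (A ⊞ Z ≅ B ⊞ Z))
    (h' : Nonempty (B ⊞ Z' ≅ C ⊞ Z')) : Nonempty (A ⊞ (Z ⊞ Z') ≅ C ⊞ (Z ⊞ Z')) := by
  obtain ⟨e⟩ := h
  obtain ⟨e'⟩ := h'
  exact ⟨(biprod.associator A Z Z').symm ≪≫ biprod.mapIso e (Iso.refl Z') ≪≫
    biprod.associator B Z Z' ≪≫ biprod.mapIso (Iso.refl B) (biprod.braiding Z Z') ≪≫
    (biprod.associator B Z' Z).symm ≪≫ biprod.mapIso e' (Iso.refl Z) ≪≫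
    biprod.associator C Z' Z ≪≫ biprod.mapIso (Iso.refl C) (biprod.braiding Z' Z)⟩

end StableIsomorphism

section DeltaOrder

variable {k : Type w} [CommRing k] [IsNoetherianRing k]
  {T : Type u} [Category.{v} T] [Preadditive T] [HasZeroObject T]
  [HasShift T ℤ] [∀ n : ℤ, (shiftFunctor T n).Additive] [Pretriangulated T]
  [CategoryTheory.Linear k T]

theorem length_hom_le_of_deltaStep (hfg : ∀ X Y : T, Module.Finite k (X ⟶ Y)) {X Y : T}
    (h : deltaStep T X Y) {V : T} (hV : IsArtinianObject k V) :
    Module.length k (X ⟶ V) ≤ Module.length k (Y ⟶ V) := by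
  obtain ⟨Z, v, u, p, d, hT⟩ := h
  have := hV.isArtinian_hom hfg
  exact le_self_add.trans (length_add_length_ker_le hfg hT V)

theorem length_hom_le_of_deltaLE (hfg : ∀ X Y : T, Module.Finite k (X ⟶ Y)) {X Y : T}
    (h : deltaLE T X Y) {V : T} (hV : IsArtinianObject k V) :
    Module.length k (X ⟶ V) ≤ Module.length k (Y ⟶ V) := by
  induction h with
  | single h => exact length_hom_le_of_deltaStep hfg h hV
  | tail _ h ih => exact ih.trans (length_hom_le_of_deltaStep hfg h hV)

variable [IsIdempotentComplete T]

theorem exists_biprod_iso_of_deltaStep (hfg : ∀ X Y : T, Module.Finite k (X ⟶ Y)) {X Y : T}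
    (h : deltaStep T X Y) (hle : ∀ V : T, IsArtinianObject k V →
      Module.length k (Y ⟶ V) ≤ Module.length k (X ⟶ V)) :
    ∃ Z : T, Nonempty (X ⊞ Z ≅ Y ⊞ Z) := by
  obtain ⟨Z, v, u, p, d, hT⟩ := h
  have hpd : p ≫ d = 0 := comp_distTriang_mor_zero₂₃ _ hT
  have hd : d = 0 := eq_zero_of_forall_isArtinianObject hfg fun V hV f => by
    have := hV.isArtinian_hom hfg
    have := hfg X V
    have hlen := (length_add_length_ker_le hfg hT V).trans
      ((hle V hV).trans_eq (add_zero _).symm)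
    have hker := nonpos_iff_eq_zero.mp
      ((ENat.add_le_add_iff_left (Module.length_ne_top (R := k) (M := X ⟶ V))).mp hlen)
    have hsub := Module.length_eq_zero_iff.mp hker
    have hmem : d ≫ f ∈ LinearMap.ker (Linear.leftComp k V p) := by
      change p ≫ d ≫ f = 0
      rw [← Category.assoc, hpd, zero_comp]
    exact congrArg Subtype.val (Subsingleton.elim (⟨_, hmem⟩ : LinearMap.ker _) 0)
  obtain ⟨e⟩ : Nonempty (Z ⊞ X ≅ Z ⊞ Y) := by
    obtain ⟨e, -⟩ := exists_iso_binaryBiproduct_of_distTriang _ hT hd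
    exact ⟨e⟩
  exact ⟨Z, ⟨biprod.braiding X Z ≪≫ e ≪≫ biprod.braiding Z Y⟩⟩

theorem exists_biprod_iso_of_deltaLE (hfg : ∀ X Y : T, Module.Finite k (X ⟶ Y)) {X Y : T}
    (h : deltaLE T X Y) (hle : ∀ V : T, IsArtinianObject k V →
      Module.length k (Y ⟶ V) ≤ Module.length k (X ⟶ V)) :
    ∃ Z : T, Nonempty (X ⊞ Z ≅ Y ⊞ Z) := by
  induction h with
  | single h => exact exists_biprod_iso_of_deltaStep hfg h hle
  | tail hXB hBY ih =>
    obtain ⟨Z, hZ⟩ := ih fun V hV => (length_hom_le_of_deltaStep hfg hBY hV).trans (hle V hV)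
    obtain ⟨Z', hZ'⟩ := exists_biprod_iso_of_deltaStep hfg hBY fun V hV =>
      (hle V hV).trans (length_hom_le_of_deltaLE hfg hXB hV)
    exact ⟨Z ⊞ Z', nonempty_biprod_iso_trans hZ hZ'⟩

end DeltaOrder

/-- Let `k` be a commutative Noetherian ring and `T` a skeletally small
`k`-linear triangulated category with split idempotents such that all Hom-spaces are
finitely generated `k`-modules, and such that for all `X, Y` there is an integer `n` with
`Hom_T(X,Y[j]) = 0` for all `j > n`. If `M ⪯_Δ N` and `N ⪯_Δ M` then there is an object
`Z` with `M ⊕ Z ≅ N ⊕ Z`. -/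
theorem stmt_6 (k : Type w) [CommRing k] [IsNoetherianRing k]
    (T : Type u) [Category.{v} T] [Preadditive T] [HasZeroObject T]
    [HasShift T ℤ] [∀ n : ℤ, (shiftFunctor T n).Additive] [Pretriangulated T]
    [IsTriangulated T] [CategoryTheory.Linear k T] [IsIdempotentComplete T]
    [EssentiallySmall.{v} T]
    (hfg : ∀ X Y : T, Module.Finite k (X ⟶ Y))
    (hvanish : ∀ X Y : T, ∃ n : ℤ, ∀ j > n, ∀ f : X ⟶ Y⟦j⟧, f = 0)
    (M N : T) (hMN : deltaLE T M N) (hNM : deltaLE T N M) :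
    ∃ Z : T, Nonempty (M ⊞ Z ≅ N ⊞ Z) := by
  exact exists_biprod_iso_of_deltaLE hfg hMN fun V hV => length_hom_le_of_deltaLE hfg hNM hV
end

section
/- Let R be a commutative ring and let U →(α,β)ᵗ U ⊕ V →(γ,δ) W → 0 be an exact sequence of R-modules in which U, V and W have finite length. If for every R-module Y of finite length one has length_R(Hom_R(V,Y)) = length_R(Hom_R(W,Y)), then (α,β)ᵗ : U → U ⊕ V is a monomorphism and the resulting short exact sequence 0 → U → U ⊕ V → W → 0 is split exact; in particular it remains exact after applying Hom_R(−, Y) for any R-module Y of finite length. -/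
universe u

/-- The composition length of an `R`-module `M`, defined as the Krull dimension of its
lattice of submodules (for modules of finite length this is the common length of any
composition series, by the Jordan–Hölder theorem). -/
noncomputable def moduleLength (R M : Type*) [Semiring R] [AddCommMonoid M] [Module R M] :
    WithBot ℕ∞ :=
  Order.krullDim (Submodule R M)

section

variable {R M N Y : Type*} [CommRing R] [AddCommGroup M] [Module R M] [AddCommGroup N]
  [Module R N] [AddCommGroup Y] [Module R Y]

theorem moduleLength_eq_coe_length : moduleLength R M = (Module.length R M : WithBot ℕ∞) :=
  (Module.coe_length R M).symm

theorem isFiniteLength_linearMap [Module.Finite R M] (hY : IsFiniteLength R Y) :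
    IsFiniteLength R (M →ₗ[R] Y) := by
  obtain ⟨n, f, hf⟩ := Module.Finite.exists_fin' R M
  have hle := Module.length_le_of_injective (LinearMap.lcomp R Y f)
    (LinearMap.lcomp_injective_of_surjective f hf)
  rw [← ((Pi.basisFun R (Fin n)).constr R (M' := Y)).length_eq, Module.length_pi] at hle
  rw [← Module.length_ne_top_iff] at hY ⊢
  exact ne_top_of_le_ne_top (WithTop.mul_ne_top ENat.card_lt_top_of_finite.ne hY) hle

theorem Submodule.eq_top_of_length_eq (hM : IsFiniteLength R M) {P : Submodule R M}
    (h : Module.length R P = Module.length R M) : P = ⊤ := by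
  obtain ⟨_, _⟩ := isFiniteLength_iff_isNoetherian_isArtinian.mp hM
  by_contra hP
  exact (Submodule.length_lt hP).ne h

/-- In a left exact sequence `0 → N → M → Y` of finite length modules whose lengths add up,
the last map is surjective. -/
theorem LinearMap.surjective_of_exact_of_length_eq_add {f : N →ₗ[R] M} {g : M →ₗ[R] Y}
    (hN : IsFiniteLength R N) (hY : IsFiniteLength R Y) (hf : Function.Injective f)
    (hfg : Function.Exact f g)
    (hlen : Module.length R M = Module.length R N + Module.length R Y) :
    Function.Surjective g := by
  have hexact : Function.Exact f g.rangeRestrict := fun x => by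
    rw [← hfg x, ← Subtype.coe_inj]
    rfl
  have hadd := Module.length_eq_add_of_exact f g.rangeRestrict hf g.surjective_rangeRestrict hexact
  exact LinearMap.range_eq_top.mp <| Submodule.eq_top_of_length_eq hY <|
    ENat.add_right_injective_of_ne_top (Module.length_ne_top_iff.mpr hN) (hadd.symm.trans hlen)

end

/-- Let `R` be a commutative ring and let
`U →(α,β)ᵗ U ⊕ V →(γ,δ) W → 0` be an exact sequence of `R`-modules of finite length.
If `length_R Hom_R(V,Y) = length_R Hom_R(W,Y)` for every `R`-module `Y` of finite length,
then `(α,β)ᵗ : U → U ⊕ V` is a monomorphism and the resulting short exact sequence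
`0 → U → U ⊕ V → W → 0` is split exact; in particular it remains exact after applying
`Hom_R(−,Y)` for any `R`-module `Y` of finite length. -/
theorem stmt_11 {R : Type u} [CommRing R]
    {U V W : Type u} [AddCommGroup U] [Module R U] [AddCommGroup V] [Module R V]
    [AddCommGroup W] [Module R W]
    (hU : IsFiniteLength R U) (hV : IsFiniteLength R V) (hW : IsFiniteLength R W)
    (α : U →ₗ[R] U) (β : U →ₗ[R] V) (γ : U →ₗ[R] W) (δ : V →ₗ[R] W)
    (hexact : Function.Exact (LinearMap.prod α β) (LinearMap.coprod γ δ))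
    (hsurj : Function.Surjective (LinearMap.coprod γ δ))
    (hlen : ∀ (Y : Type u) [AddCommGroup Y] [Module R Y], IsFiniteLength R Y →
      moduleLength R (V →ₗ[R] Y) = moduleLength R (W →ₗ[R] Y)) :
    Function.Injective (LinearMap.prod α β) ∧
      (∃ r : U × V →ₗ[R] U, r.comp (LinearMap.prod α β) = LinearMap.id) ∧
      ∀ (Y : Type u) [AddCommGroup Y] [Module R Y], IsFiniteLength R Y →
        (Function.Injective
            (fun g : W →ₗ[R] Y => g.comp (LinearMap.coprod γ δ)) ∧
          Function.Exact
            (fun g : W →ₗ[R] Y => g.comp (LinearMap.coprod γ δ))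
            (fun g : U × V →ₗ[R] Y => g.comp (LinearMap.prod α β)) ∧
          Function.Surjective
            (fun g : U × V →ₗ[R] Y => g.comp (LinearMap.prod α β))) := by
  obtain ⟨_, _⟩ := isFiniteLength_iff_isNoetherian_isArtinian.mp hU
  obtain ⟨_, _⟩ := isFiniteLength_iff_isNoetherian_isArtinian.mp hW
  have hlenU : Module.length R (V →ₗ[R] U) = Module.length R (W →ₗ[R] U) := by
    simpa only [moduleLength_eq_coe_length, WithBot.coe_inj] using hlen U hU
  have hlift : Function.Surjective (LinearMap.lcomp R U (LinearMap.prod α β)) := by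
    refine LinearMap.surjective_of_exact_of_length_eq_add (isFiniteLength_linearMap hU)
      (isFiniteLength_linearMap hU) (LinearMap.lcomp_injective_of_surjective _ hsurj)
      (LinearMap.exact_lcomp_of_exact_of_surjective U hexact hsurj) ?_
    rw [← (LinearMap.coprodEquiv R).length_eq, Module.length_prod, hlenU, add_comm]
  obtain ⟨r, hr⟩ := hlift LinearMap.id
  have hr : r.comp (LinearMap.prod α β) = LinearMap.id := hr
  refine ⟨Function.LeftInverse.injective (LinearMap.congr_fun hr), ⟨r, hr⟩, fun Y _ _ _ =>
    ⟨hsurj.injective_linearMapComp_right,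
      LinearMap.exact_lcomp_of_exact_of_surjective Y hexact hsurj,
      fun g => ⟨g.comp r, ?_⟩⟩⟩
  simp only [LinearMap.comp_assoc, hr, LinearMap.comp_id]
end
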